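/- Define the large Schröder numbers S : ℕ → ℕ by S 0 = 1 and S (n+1) = S n + ∑_{j=0}^{n} S j · S (n−j). Then for every n ≥ 2, twice the number of full indecomposable permutations of Fin n equals S (n−1); that is, the full indecomposable permutations are enumerated by the (shifted) little Schröder numbers s (n−1) = S (n−1) / 2. -/

import Mathlib

/-- Two cells of the `n × n` board are cardinal (north/south/east/west) neighbors. -/
def Adj {n : ℕ} (c d : Fin n × Fin n) : Prop :=
  (c.1 = d.1 ∧ ((c.2 : ℕ) + 1 = (d.2 : ℕ) ∨ (d.2 : ℕ) + 1 = (c.2 : ℕ))) ∨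
  (c.2 = d.2 ∧ ((c.1 : ℕ) + 1 = (d.1 : ℕ) ∨ (d.1 : ℕ) + 1 = (c.1 : ℕ)))

/-- A cell `c` is mutable for a set `T` of cells: `c ∉ T` and at least two of its
cardinal neighbors belong to `T`. -/
def IsMutable {n : ℕ} (T : Set (Fin n × Fin n)) (c : Fin n × Fin n) : Prop :=
  c ∉ T ∧ ∃ d ∈ T, ∃ e ∈ T, d ≠ e ∧ Adj c d ∧ Adj c e

/-- One percolation step: adjoin a single mutable cell. -/
def PercStep {n : ℕ} (T T' : Set (Fin n × Fin n)) : Prop :=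
  ∃ c, IsMutable T c ∧ T' = T ∪ {c}

/-- The graph of a permutation `π`, i.e. the set of cells `(i, π i)`. -/
def graphOf {n : ℕ} (π : Equiv.Perm (Fin n)) : Set (Fin n × Fin n) :=
  {p | p.2 = π p.1}

/-- A set of cells is percolation-closed if it contains every cell having at least two
cardinal neighbors in the set. -/
def PercClosed {n : ℕ} (S : Set (Fin n × Fin n)) : Prop :=
  ∀ c, (∃ d ∈ S, ∃ e ∈ S, d ≠ e ∧ Adj c d ∧ Adj c e) → c ∈ S

/-- The percolation closure of `π`: the smallest percolation-closed set containing the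
graph of `π`. -/
def percClosure {n : ℕ} (π : Equiv.Perm (Fin n)) : Set (Fin n × Fin n) :=
  ⋂₀ {S | graphOf π ⊆ S ∧ PercClosed S}

/-- `π` is full if its percolation closure is the whole board. -/
def Full {n : ℕ} (π : Equiv.Perm (Fin n)) : Prop :=
  percClosure π = Set.univ

/-- A permutation of `Fin m` is indecomposable if it maps no proper initial segment
`{0, …, k−1}` (with `1 ≤ k < m`) onto itself. -/
def Indecomposable {m : ℕ} (σ : Equiv.Perm (Fin m)) : Prop :=
  ¬ ∃ k, 1 ≤ k ∧ k < m ∧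
    (fun i => σ i) '' {i : Fin m | (i : ℕ) < k} = {i : Fin m | (i : ℕ) < k}

/-- `π` is no-growth if no cell is mutable for its graph. -/
def NoGrowth {n : ℕ} (π : Equiv.Perm (Fin n)) : Prop :=
  ∀ c, ¬ IsMutable (graphOf π) c

/-- The number of full permutations of `Fin m`. -/
noncomputable def numFull (m : ℕ) : ℕ :=
  Nat.card {π : Equiv.Perm (Fin m) // Full π}

/-- The number of full indecomposable permutations of `Fin m`. -/
noncomputable def numFullIndec (m : ℕ) : ℕ :=
  Nat.card {π : Equiv.Perm (Fin m) // Full π ∧ Indecomposable π}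

inductive SepL : List ℕ → Prop
  | one : SepL [0]
  | inc {l m : List ℕ} : SepL l → SepL m → SepL (l ++ m.map (l.length + ·))
  | dec {l m : List ℕ} : SepL l → SepL m → SepL (l.map (m.length + ·) ++ m)

def IncL (l : List ℕ) : Prop :=
  ∃ a b, SepL a ∧ SepL b ∧ l = a ++ b.map (a.length + ·)

def DecL (l : List ℕ) : Prop :=
  ∃ a b, SepL a ∧ SepL b ∧ l = a.map (b.length + ·) ++ b

theorem SepL.perm {l : List ℕ} (h : SepL l) : l.Perm (List.range l.length) := by
  induction h with
  | one => exact List.Perm.refl _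
  | @inc l m _ _ h1 h2 =>
    simp only [List.length_append, List.length_map, List.range_add]
    exact h1.append (h2.map _)
  | @dec l m _ _ h1 h2 =>
    simp only [List.length_append, List.length_map]
    rw [Nat.add_comm, List.range_add]
    exact List.perm_append_comm.trans (h2.append (h1.map _))

theorem SepL.lt {l : List ℕ} (h : SepL l) {x : ℕ} (hx : x ∈ l) : x < l.length := by
  simpa using h.perm.mem_iff.1 hx

theorem SepL.mem {l : List ℕ} (h : SepL l) {x : ℕ} (hx : x < l.length) : x ∈ l :=
  h.perm.mem_iff.2 (by simpa using hx)

theorem SepL.nodup {l : List ℕ} (h : SepL l) : l.Nodup :=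
  h.perm.nodup_iff.2 List.nodup_range

theorem SepL.pos {l : List ℕ} (h : SepL l) : 0 < l.length := by
  induction h <;> simp <;> omega

theorem SepL.rev {l : List ℕ} (h : SepL l) : SepL l.reverse := by
  induction h with
  | one => exact SepL.one
  | @inc l m _ _ h1 h2 =>
    have := SepL.dec h2 h1
    simpa using this
  | @dec l m _ _ h1 h2 =>
    have := SepL.inc h2 h1
    simpa using this

theorem SepL.cases' {l : List ℕ} (h : SepL l) : l = [0] ∨ IncL l ∨ DecL l := by
  cases h with
  | one => left; rfl
  | inc h1 h2 => right; left; exact ⟨_, _, h1, h2, rfl⟩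
  | dec h1 h2 => right; right; exact ⟨_, _, h1, h2, rfl⟩

theorem IncL.sep {l : List ℕ} (h : IncL l) : SepL l := by
  obtain ⟨a, b, ha, hb, rfl⟩ := h; exact SepL.inc ha hb

theorem DecL.sep {l : List ℕ} (h : DecL l) : SepL l := by
  obtain ⟨a, b, ha, hb, rfl⟩ := h; exact SepL.dec ha hb

/-- If the values in the first `k` positions are `< k` and the later ones `≥ k`, no `DecL`. -/
theorem DecL.not_split {l : List ℕ} (h : DecL l) (k : ℕ) (hk : 0 < k) (hk' : k < l.length)
    (h1 : l[0]'(by omega) < k) (h2 : k ≤ l[l.length - 1]'(by omega)) : False := by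
  obtain ⟨a, b, ha, hb, rfl⟩ := h
  have pa := ha.pos
  have pb := hb.pos
  rw [List.getElem_append_left (by simpa using pa)] at h1
  rw [List.getElem_append_right (by simp; omega)] at h2
  simp only [List.getElem_map] at h1
  have := hb.lt (List.getElem_mem (l := b) (n := (a.map (b.length + ·) ++ b).length - 1 - (a.map (b.length + ·)).length) (by simp; omega))
  omega

theorem DecL.not_inc {l : List ℕ} (h : DecL l) : ¬ IncL l := by
  rintro ⟨a, b, ha, hb, rfl⟩
  have pa := ha.pos
  have pb := hb.pos
  refine h.not_split a.length pa (by simp; omega) ?_ ?_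
  · rw [List.getElem_append_left pa]
    exact ha.lt (List.getElem_mem _)
  · rw [List.getElem_append_right (by simp; omega)]
    simp

theorem IncL.rev {l : List ℕ} (h : IncL l) : DecL l.reverse := by
  obtain ⟨a, b, ha, hb, rfl⟩ := h
  exact ⟨_, _, hb.rev, ha.rev, by simp⟩

theorem DecL.rev {l : List ℕ} (h : DecL l) : IncL l.reverse := by
  obtain ⟨a, b, ha, hb, rfl⟩ := h
  exact ⟨_, _, hb.rev, ha.rev, by simp⟩

theorem SepL.exists_first {l : List ℕ} (h : SepL l) : IncL l →
    ∃ a b, SepL a ∧ ¬ IncL a ∧ SepL b ∧ l = a ++ b.map (a.length + ·) := by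
  induction h with
  | one =>
    rintro ⟨a, b, ha, hb, h⟩
    have := congrArg List.length h
    have := ha.pos
    have := hb.pos
    simp at *
    omega
  | @inc a b ha hb h1 h2 =>
    intro _
    by_cases hi : IncL a
    · obtain ⟨u, v, hu, hu', hv, rfl⟩ := h1 hi
      refine ⟨u, v ++ b.map (v.length + ·), hu, hu', SepL.inc hv hb, ?_⟩
      simp [Nat.add_assoc]
    · exact ⟨a, b, ha, hi, hb, rfl⟩
  | @dec a b ha hb h1 h2 =>
    intro h
    exact absurd h (DecL.not_inc ⟨a, b, ha, hb, rfl⟩)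

theorem first_aux {a b a' b' : List ℕ} (ha : SepL a) (ha' : SepL a') (hi : ¬ IncL a')
    (h : a ++ b.map (a.length + ·) = a' ++ b'.map (a'.length + ·)) : a'.length ≤ a.length := by
  by_contra hlt
  push Not at hlt
  have pa := ha.pos
  have pa' := ha'.pos
  rcases ha'.cases' with rfl | h' | h'
  · simp only [List.length_singleton] at hlt; omega
  · exact hi h'
  · have key : ∀ i (h : i < a'.length), a'[i]? = (a ++ b.map (a.length + ·))[i]? := by
      intro i hh
      rw [h, List.getElem?_append_left hh]
    refine h'.not_split a.length pa hlt ?_ ?_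
    · have := key 0 pa'
      rw [List.getElem?_append_left pa, List.getElem?_eq_getElem pa, List.getElem?_eq_getElem pa'] at this
      rw [Option.some.inj this]
      exact ha.lt (List.getElem_mem _)
    · have := key (a'.length - 1) (by omega)
      rw [List.getElem?_append_right (by omega), List.getElem?_eq_getElem (by omega), List.getElem?_map] at this
      cases hx : b[a'.length - 1 - a.length]? with
      | none => rw [hx] at this; simp at this
      | some x =>
        rw [hx] at this
        simp only [Option.map_some, Option.some.injEq] at this
        omega

theorem first_unique {a b a' b' : List ℕ} (ha : SepL a) (hi : ¬ IncL a) (ha' : SepL a')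
    (hi' : ¬ IncL a')
    (h : a ++ b.map (a.length + ·) = a' ++ b'.map (a'.length + ·)) : a = a' ∧ b = b' := by
  have h1 := first_aux ha ha' hi' h
  have h2 := first_aux ha' ha hi h.symm
  have he : a.length = a'.length := by omega
  obtain ⟨h3, h4⟩ := List.append_inj h he
  subst h3
  exact ⟨rfl, List.map_injective_iff.2 (add_right_injective _) h4⟩

/-! counting -/

theorem finite_sep (n : ℕ) : {l | SepL l ∧ l.length = n}.Finite := by
  refine Set.Finite.subset ((List.finite_length_eq (Fin n) n).image (List.map Fin.val)) ?_
  rintro l ⟨h, hl⟩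
  subst hl
  refine ⟨l.attach.map (fun x => ⟨x.1, h.lt x.2⟩), by simp, ?_⟩
  simp [List.map_map, Function.comp_def]

noncomputable def setA (n : ℕ) : Finset (List ℕ) := (finite_sep n).toFinset

theorem mem_setA {n : ℕ} {l : List ℕ} : l ∈ setA n ↔ SepL l ∧ l.length = n := by
  simp [setA]

open Classical in
noncomputable def setI (n : ℕ) : Finset (List ℕ) := (setA n).filter (fun l => ¬ IncL l)

open Classical in
noncomputable def setJ (n : ℕ) : Finset (List ℕ) := (setA n).filter (fun l => IncL l)

theorem mem_setI {n : ℕ} {l : List ℕ} : l ∈ setI n ↔ (SepL l ∧ l.length = n) ∧ ¬ IncL l := by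
  simp [setI, mem_setA]

theorem mem_setJ {n : ℕ} {l : List ℕ} : l ∈ setJ n ↔ (SepL l ∧ l.length = n) ∧ IncL l := by
  simp [setJ, mem_setA]

theorem card_A (n : ℕ) : (setA n).card = (setI n).card + (setJ n).card := by
  classical
  rw [Nat.add_comm]
  unfold setI setJ
  rw [Finset.card_filter_add_card_filter_not]

theorem card_IJ {n : ℕ} (hn : 2 ≤ n) : (setI n).card = (setJ n).card := by
  refine Finset.card_bij' (fun l _ => l.reverse) (fun l _ => l.reverse) ?_ ?_ ?_ ?_
  · intro l hl
    rw [mem_setI] at hl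
    obtain ⟨⟨h1, h2⟩, h3⟩ := hl
    rw [mem_setJ]
    refine ⟨⟨h1.rev, by simpa using h2⟩, ?_⟩
    rcases h1.cases' with rfl | h | h
    · simp at h2; omega
    · exact absurd h h3
    · exact h.rev
  · intro l hl
    rw [mem_setJ] at hl
    obtain ⟨⟨h1, h2⟩, h3⟩ := hl
    rw [mem_setI]
    exact ⟨⟨h1.rev, by simpa using h2⟩, h3.rev.not_inc⟩
  · simp
  · simp

theorem card_J (n : ℕ) :
    (setJ n).card = ∑ p ∈ Finset.HasAntidiagonal.antidiagonal n, (setI p.1).card * (setA p.2).card := by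
  classical
  simp_rw [← Finset.card_product]
  rw [← Finset.card_sigma]
  symm
  refine Finset.card_bij (fun x _ => x.2.1 ++ x.2.2.map (x.2.1.length + ·)) ?_ ?_ ?_
  · rintro ⟨⟨p, q⟩, ⟨a, b⟩⟩ h
    simp only [Finset.mem_sigma, Finset.HasAntidiagonal.mem_antidiagonal, Finset.mem_product, mem_setI, mem_setA] at h
    obtain ⟨rfl, ⟨⟨h1, rfl⟩, h3⟩, h4, rfl⟩ := h
    rw [mem_setJ]
    exact ⟨⟨SepL.inc h1 h4, by simp⟩, a, b, h1, h4, rfl⟩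
  · rintro ⟨⟨p, q⟩, ⟨a, b⟩⟩ h ⟨⟨p', q'⟩, ⟨a', b'⟩⟩ h' he
    simp only [Finset.mem_sigma, Finset.HasAntidiagonal.mem_antidiagonal, Finset.mem_product, mem_setI, mem_setA] at h h'
    obtain ⟨_, ⟨⟨h1, rfl⟩, h3⟩, h4, rfl⟩ := h
    obtain ⟨_, ⟨⟨h1', rfl⟩, h3'⟩, h4', rfl⟩ := h'
    obtain ⟨rfl, rfl⟩ := first_unique h1 h3 h1' h3' he
    rfl
  · intro l hl
    rw [mem_setJ] at hl
    obtain ⟨⟨h1, rfl⟩, h3⟩ := hl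
    obtain ⟨a, b, ha, hi, hb, rfl⟩ := h1.exists_first h3
    refine ⟨⟨(a.length, b.length), (a, b)⟩, ?_, rfl⟩
    simp [mem_setI, mem_setA, ha, hi, hb]

theorem A_zero : setA 0 = ∅ := by
  ext l
  simp only [mem_setA, Finset.notMem_empty, iff_false]
  rintro ⟨h, h'⟩
  have := h.pos
  omega

theorem one_not_inc {l : List ℕ} (hl : l.length = 1) : ¬ IncL l := by
  rintro ⟨a, b, ha, hb, rfl⟩
  have := ha.pos
  have := hb.pos
  simp at hl
  omega

theorem A_one : setA 1 = {[0]} := by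
  ext l
  simp only [mem_setA, Finset.mem_singleton]
  constructor
  · rintro ⟨h, h'⟩
    obtain ⟨x, rfl⟩ := List.length_eq_one_iff.1 h'
    have := h.lt (x := x) (by simp)
    simp at this
    rw [this]
  · rintro rfl
    exact ⟨SepL.one, rfl⟩

theorem I_one : setI 1 = setA 1 := by
  ext l
  rw [mem_setI, mem_setA]
  exact ⟨fun h => h.1, fun h => ⟨h, one_not_inc h.2⟩⟩

theorem I_zero : setI 0 = ∅ := by
  classical
  simp [setI, A_zero]

theorem two_I (k : ℕ) : 2 * (setI k).card = (setA k).card + if k = 1 then 1 else 0 := by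
  rcases k with _ | _ | k
  · simp [I_zero, A_zero]
  · simp [I_one, A_one]
  · have := card_A (k + 2)
    have := card_IJ (n := k + 2) (by omega)
    rw [if_neg (by omega)]
    simp only [Nat.add_assoc, Nat.reduceAdd] at *
    omega

theorem card_rec (m : ℕ) : (setA (m + 2)).card = (setA (m + 1)).card +
    ∑ j ∈ Finset.range (m + 1), (setA (j + 1)).card * (setA (m - j + 1)).card := by
  have h1 := card_J (m + 2)
  have h2 := card_A (m + 2)
  have h3 := card_IJ (n := m + 2) (by omega)
  have h4 : (setA (m + 2)).card = ∑ p ∈ Finset.HasAntidiagonal.antidiagonal (m + 2),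
      (2 * (setI p.1).card) * (setA p.2).card := by
    simp_rw [Nat.mul_assoc]
    rw [← Finset.mul_sum]
    omega
  rw [h4]
  simp_rw [two_I, Nat.add_mul]
  rw [Finset.sum_add_distrib, Nat.add_comm]
  congr 1
  · rw [Finset.Nat.sum_antidiagonal_eq_sum_range_succ_mk]
    rw [Finset.sum_eq_single 1]
    · simp
    · intro b _ hb; simp [hb]
    · simp
  · rw [Finset.Nat.sum_antidiagonal_eq_sum_range_succ_mk, Finset.sum_range_succ', Finset.sum_range_succ]
    simp only [A_zero, Nat.sub_self, Finset.card_empty, Nat.zero_mul, Nat.mul_zero, Nat.add_zero]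
    refine Finset.sum_congr rfl fun j hj => ?_
    rw [Finset.mem_range] at hj
    rw [show m + 2 - (j + 1) = m - j + 1 by omega]

theorem card_A_S (S : ℕ → ℕ) (hS0 : S 0 = 1)
    (hS : ∀ n, S (n + 1) = S n + ∑ j ∈ Finset.range (n + 1), S j * S (n - j)) (m : ℕ) :
    (setA (m + 1)).card = S m := by
  induction m using Nat.strong_induction_on with
  | _ m ih =>
    rcases m with _ | m
    · simp [A_one, hS0]
    · rw [hS, card_rec, ih m (by omega)]
      congr 1
      refine Finset.sum_congr rfl fun j hj => ?_
      rw [Finset.mem_range] at hj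
      rw [ih j (by omega), ih (m - j) (by omega)]

/-! geometry -/

/-- natural number version of membership -/
def TN {n : ℕ} (T : Set (Fin n × Fin n)) (i j : ℕ) : Prop :=
  ∃ (hi : i < n) (hj : j < n), ((⟨i, hi⟩, ⟨j, hj⟩) : Fin n × Fin n) ∈ T

theorem TN.step {n : ℕ} {T : Set (Fin n × Fin n)} (hT : PercClosed T) {i j i' j' : ℕ}
    (hi : i' = i + 1 ∨ i = i' + 1) (hj : j' = j + 1 ∨ j = j' + 1)
    (h1 : TN T i' j) (h2 : TN T i j') : TN T i j := by
  obtain ⟨a1, b1, h1⟩ := h1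
  obtain ⟨a2, b2, h2⟩ := h2
  refine ⟨a2, b1, hT _ ⟨_, h1, _, h2, ?_, ?_, ?_⟩⟩
  · intro h
    simp only [Prod.mk.injEq, Fin.mk.injEq] at h
    omega
  · right
    refine ⟨rfl, ?_⟩
    simp only
    omega
  · left
    refine ⟨rfl, ?_⟩
    simp only
    omega

theorem TN.merge_inc {n : ℕ} {T : Set (Fin n × Fin n)} (hT : PercClosed T) {a c k l : ℕ}
    (h1 : ∀ i j, a ≤ i → i < a + k → c ≤ j → j < c + k → TN T i j)
    (h2 : ∀ i j, a + k ≤ i → i < a + k + l → c + k ≤ j → j < c + k + l → TN T i j)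
    (i j : ℕ) (hi : a ≤ i) (hi' : i < a + (k + l)) (hj : c ≤ j) (hj' : j < c + (k + l)) :
    TN T i j := by
  have A : ∀ N i j, a ≤ i → i < a + k → c + k ≤ j → j < c + k + l → (a + k - i) + (j - (c + k)) ≤ N →
      TN T i j := by
    intro N
    induction N with
    | zero => intros; omega
    | succ N ih =>
      intro i j h3 h4 h5 h6 h7
      refine TN.step hT (i' := i + 1) (j' := j - 1) (by omega) (by omega) ?_ ?_
      · by_cases h : i + 1 < a + k
        · exact ih _ _ (by omega) h h5 h6 (by omega)
        · exact h2 _ _ (by omega) (by omega) h5 h6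
      · by_cases h : c + k ≤ j - 1
        · exact ih _ _ h3 h4 h (by omega) (by omega)
        · exact h1 _ _ h3 h4 (by omega) (by omega)
  have B : ∀ N i j, a + k ≤ i → i < a + k + l → c ≤ j → j < c + k → (i - (a + k)) + (c + k - j) ≤ N →
      TN T i j := by
    intro N
    induction N with
    | zero => intros; omega
    | succ N ih =>
      intro i j h3 h4 h5 h6 h7
      refine TN.step hT (i' := i - 1) (j' := j + 1) (by omega) (by omega) ?_ ?_
      · by_cases h : a + k ≤ i - 1
        · exact ih _ _ h (by omega) h5 h6 (by omega)
        · exact h1 _ _ (by omega) (by omega) h5 h6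
      · by_cases h : j + 1 < c + k
        · exact ih _ _ h3 h4 (by omega) h (by omega)
        · exact h2 _ _ h3 h4 (by omega) (by omega)
  by_cases h : i < a + k <;> by_cases h' : j < c + k
  · exact h1 _ _ hi h hj h'
  · exact A _ _ _ hi h (by omega) (by omega) le_rfl
  · exact B _ _ _ (by omega) (by omega) hj h' le_rfl
  · exact h2 _ _ (by omega) (by omega) (by omega) (by omega)

theorem TN.merge_dec {n : ℕ} {T : Set (Fin n × Fin n)} (hT : PercClosed T) {a c k l : ℕ}
    (h1 : ∀ i j, a ≤ i → i < a + k → c + l ≤ j → j < c + l + k → TN T i j)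
    (h2 : ∀ i j, a + k ≤ i → i < a + k + l → c ≤ j → j < c + l → TN T i j)
    (i j : ℕ) (hi : a ≤ i) (hi' : i < a + (k + l)) (hj : c ≤ j) (hj' : j < c + (k + l)) :
    TN T i j := by
  have A : ∀ N i j, a ≤ i → i < a + k → c ≤ j → j < c + l → (a + k - i) + (c + l - j) ≤ N →
      TN T i j := by
    intro N
    induction N with
    | zero => intros; omega
    | succ N ih =>
      intro i j h3 h4 h5 h6 h7
      refine TN.step hT (i' := i + 1) (j' := j + 1) (by omega) (by omega) ?_ ?_
      · by_cases h : i + 1 < a + k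
        · exact ih _ _ (by omega) h h5 h6 (by omega)
        · exact h2 _ _ (by omega) (by omega) h5 h6
      · by_cases h : j + 1 < c + l
        · exact ih _ _ h3 h4 (by omega) h (by omega)
        · exact h1 _ _ h3 h4 (by omega) (by omega)
  have B : ∀ N i j, a + k ≤ i → i < a + k + l → c + l ≤ j → j < c + l + k →
      (i - (a + k)) + (j - (c + l)) ≤ N → TN T i j := by
    intro N
    induction N with
    | zero =>
      intro i j h3 h4 h5 h6 h7
      refine TN.step hT (i' := i - 1) (j' := j - 1) (by omega) (by omega) ?_ ?_
      · exact h1 _ _ (by omega) (by omega) h5 h6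
      · exact h2 _ _ h3 h4 (by omega) (by omega)
    | succ N ih =>
      intro i j h3 h4 h5 h6 h7
      refine TN.step hT (i' := i - 1) (j' := j - 1) (by omega) (by omega) ?_ ?_
      · by_cases h : a + k ≤ i - 1
        · exact ih _ _ h (by omega) h5 h6 (by omega)
        · exact h1 _ _ (by omega) (by omega) h5 h6
      · by_cases h : c + l ≤ j - 1
        · exact ih _ _ h3 h4 h (by omega) (by omega)
        · exact h2 _ _ h3 h4 (by omega) (by omega)
  by_cases h : i < a + k <;> by_cases h' : j < c + l
  · exact A _ _ _ hi h hj h' le_rfl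
  · exact h1 _ _ hi h (by omega) (by omega)
  · exact h2 _ _ (by omega) (by omega) hj h'
  · exact B _ _ _ (by omega) (by omega) (by omega) (by omega) le_rfl

/-- The pattern of `f` on `[a, a + b.length)` is `c + b`. -/
def Pat (f : ℕ → ℕ) (a c : ℕ) (b : List ℕ) : Prop :=
  (List.range' a b.length).map f = b.map (c + ·)

theorem pat_inc {f : ℕ → ℕ} {a c : ℕ} {b b' : List ℕ} :
    Pat f a c (b ++ b'.map (b.length + ·)) ↔ Pat f a c b ∧ Pat f (a + b.length) (c + b.length) b' := by
  unfold Pat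
  rw [List.length_append, List.length_map, ← List.range'_append_1, List.map_append, List.map_append]
  constructor
  · intro h
    obtain ⟨h1, h2⟩ := List.append_inj h (by simp)
    refine ⟨h1, ?_⟩
    rw [h2]
    simp [Nat.add_assoc]
  · rintro ⟨h1, h2⟩
    rw [h1, h2]
    simp [Nat.add_assoc]

theorem pat_dec {f : ℕ → ℕ} {a c : ℕ} {b b' : List ℕ} :
    Pat f a c (b.map (b'.length + ·) ++ b') ↔ Pat f a (c + b'.length) b ∧ Pat f (a + b.length) c b' := by
  unfold Pat
  rw [List.length_append, List.length_map, ← List.range'_append_1, List.map_append, List.map_append]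
  constructor
  · intro h
    obtain ⟨h1, h2⟩ := List.append_inj h (by simp)
    refine ⟨?_, h2⟩
    rw [h1]
    simp [Nat.add_assoc]
  · rintro ⟨h1, h2⟩
    rw [h1, h2]
    simp [Nat.add_assoc]

theorem sep_square {n : ℕ} {T : Set (Fin n × Fin n)} (hT : PercClosed T) {f : ℕ → ℕ}
    (hf : ∀ i, i < n → TN T i (f i)) {b : List ℕ} (hb : SepL b) :
    ∀ a c, a + b.length ≤ n → Pat f a c b →
      ∀ i j, a ≤ i → i < a + b.length → c ≤ j → j < c + b.length → TN T i j := by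
  induction hb with
  | one =>
    intro a c h hp i j h1 h2 h3 h4
    simp [Pat] at hp h h2 h4
    obtain rfl : i = a := by omega
    obtain rfl : j = c := by omega
    rw [← hp]
    exact hf _ h
  | @inc b b' _ _ ih1 ih2 =>
    intro a c h hp
    rw [pat_inc] at hp
    simp only [List.length_append, List.length_map] at h ⊢
    exact TN.merge_inc hT (ih1 a c (by omega) hp.1) (ih2 _ _ (by omega) hp.2)
  | @dec b b' _ _ ih1 ih2 =>
    intro a c h hp
    rw [pat_dec] at hp
    simp only [List.length_append, List.length_map] at h ⊢
    exact TN.merge_dec hT (ih1 _ _ (by omega) hp.1) (ih2 _ _ (by omega) hp.2)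

def toF {n : ℕ} (π : Equiv.Perm (Fin n)) (i : ℕ) : ℕ := if h : i < n then (π ⟨i, h⟩ : ℕ) else i

def toL {n : ℕ} (π : Equiv.Perm (Fin n)) : List ℕ := (List.range n).map (toF π)

theorem toL_length {n : ℕ} (π : Equiv.Perm (Fin n)) : (toL π).length = n := by simp [toL]

theorem pat_toL {n : ℕ} (π : Equiv.Perm (Fin n)) : Pat (toF π) 0 0 (toL π) := by
  unfold Pat
  rw [toL_length]
  simp [toL, List.range_eq_range']

theorem full_of_sep {n : ℕ} (π : Equiv.Perm (Fin n)) (h : SepL (toL π)) : Full π := by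
  unfold Full percClosure
  rw [Set.eq_univ_iff_forall]
  rintro ⟨x, y⟩ T ⟨hg, hT⟩
  have hf : ∀ i, i < n → TN T i (toF π i) := by
    intro i hi
    unfold toF
    rw [dif_pos hi]
    refine ⟨hi, (π ⟨i, hi⟩).2, hg ?_⟩
    simp [graphOf]
  have := sep_square hT hf h 0 0 (by simp [toL_length]) (pat_toL π) x y (by omega)
    (by simp [toL_length]) (by omega) (by simp [toL_length])
  obtain ⟨_, _, this⟩ := this
  exact this

/-! full implies separable -/

/-- block with start row `q.1`, start column `q.2.1`, size `q.2.2` -/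
def Bk (f : ℕ → ℕ) (q : ℕ × ℕ × ℕ) : Prop :=
  ∃ b, SepL b ∧ b.length = q.2.2 ∧ Pat f q.1 q.2.1 b

theorem Bk.pos {f : ℕ → ℕ} {q : ℕ × ℕ × ℕ} (h : Bk f q) : 0 < q.2.2 := by
  obtain ⟨b, hb, hl, _⟩ := h
  rw [← hl]; exact hb.pos

theorem Bk.maps {f : ℕ → ℕ} {q : ℕ × ℕ × ℕ} (h : Bk f q) {i : ℕ} (h1 : q.1 ≤ i)
    (h2 : i < q.1 + q.2.2) : q.2.1 ≤ f i ∧ f i < q.2.1 + q.2.2 := by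
  obtain ⟨b, hb, hl, hp⟩ := h
  have : f i ∈ (List.range' q.1 b.length).map f :=
    List.mem_map_of_mem (by simp [List.mem_range'_1]; omega)
  rw [hp, List.mem_map] at this
  obtain ⟨x, hx, he⟩ := this
  have := hb.lt hx
  omega

theorem Bk.hits {f : ℕ → ℕ} {q : ℕ × ℕ × ℕ} (h : Bk f q) {j : ℕ} (h1 : q.2.1 ≤ j)
    (h2 : j < q.2.1 + q.2.2) : ∃ i, q.1 ≤ i ∧ i < q.1 + q.2.2 ∧ f i = j := by
  obtain ⟨b, hb, hl, hp⟩ := h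
  have : j ∈ b.map (q.2.1 + ·) := by
    rw [List.mem_map]
    exact ⟨j - q.2.1, hb.mem (by omega), by omega⟩
  rw [← hp, List.mem_map] at this
  obtain ⟨x, hx, he⟩ := this
  rw [List.mem_range'_1] at hx
  exact ⟨x, by omega, by omega, he⟩

theorem Bk.inc {f : ℕ → ℕ} {a c k l : ℕ} (h : Bk f (a, c, k)) (h' : Bk f (a + k, c + k, l)) :
    Bk f (a, c, k + l) := by
  obtain ⟨b, hb, hl, hp⟩ := h
  obtain ⟨b', hb', hl', hp'⟩ := h'
  simp only at hl hl' hp hp'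
  subst hl hl'
  exact ⟨_, SepL.inc hb hb', by simp, pat_inc.2 ⟨hp, hp'⟩⟩

theorem Bk.dec {f : ℕ → ℕ} {a c k l : ℕ} (h : Bk f (a, c + l, k)) (h' : Bk f (a + k, c, l)) :
    Bk f (a, c, k + l) := by
  obtain ⟨b, hb, hl, hp⟩ := h
  obtain ⟨b', hb', hl', hp'⟩ := h'
  simp only at hl hl' hp hp'
  subst hl hl'
  exact ⟨_, SepL.dec hb hb', by simp, pat_dec.2 ⟨hp, hp'⟩⟩

def InR (q : ℕ × ℕ × ℕ) (i : ℕ) : Prop := q.1 ≤ i ∧ i < q.1 + q.2.2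
def InC (q : ℕ × ℕ × ℕ) (j : ℕ) : Prop := q.2.1 ≤ j ∧ j < q.2.1 + q.2.2

structure Fam (n : ℕ) (f : ℕ → ℕ) (F : Finset (ℕ × ℕ × ℕ)) : Prop where
  bk : ∀ q ∈ F, Bk f q
  le : ∀ q ∈ F, q.1 + q.2.2 ≤ n
  cov : ∀ i, i < n → ∃ q ∈ F, InR q i
  uniq : ∀ q ∈ F, ∀ q' ∈ F, ∀ i, InR q i → InR q' i → q = q'

theorem Fam.merge {n : ℕ} {f : ℕ → ℕ} {F : Finset (ℕ × ℕ × ℕ)} (hF : Fam n f F)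
    {q q' : ℕ × ℕ × ℕ} (hq : q ∈ F) (hq' : q' ∈ F) (hr : q'.1 = q.1 + q.2.2)
    (hc : q'.2.1 = q.2.1 + q.2.2 ∨ q.2.1 = q'.2.1 + q'.2.2) :
    ∃ F', Fam n f F' ∧ F'.card < F.card := by
  obtain ⟨a, c, k⟩ := q
  obtain ⟨a', c', l⟩ := q'
  simp only at hr hc
  subst hr
  have b1 := hF.bk _ hq
  have b2 := hF.bk _ hq'
  have p1 := b1.pos
  have p2 := b2.pos
  have l2 := hF.le _ hq'
  simp only at p1 p2 l2
  have hne : ((a, c, k) : ℕ × ℕ × ℕ) ≠ (a + k, c', l) := by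
    intro h
    simp only [Prod.mk.injEq] at h
    omega
  obtain ⟨c0, hb⟩ : ∃ c0, Bk f (a, c0, k + l) := by
    rcases hc with rfl | rfl
    · exact ⟨c, b1.inc b2⟩
    · exact ⟨c', b1.dec b2⟩
  have hother : ∀ q ∈ F, q ≠ (a, c, k) → q ≠ (a + k, c', l) → ∀ i, InR q i →
      InR (a, c0, k + l) i → False := by
    intro q hq0 h1 h2 i hi hi'
    simp only [InR] at hi'
    by_cases h : i < a + k
    · exact h1 (hF.uniq _ hq0 _ hq i hi ⟨by simp only; omega, by simp only; omega⟩)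
    · exact h2 (hF.uniq _ hq0 _ hq' i hi ⟨by simp only; omega, by simp only; omega⟩)
  refine ⟨insert (a, c0, k + l) ((F.erase (a, c, k)).erase (a + k, c', l)), ⟨?_, ?_, ?_, ?_⟩, ?_⟩
  · intro q h
    simp only [Finset.mem_insert, Finset.mem_erase] at h
    rcases h with rfl | h
    · exact hb
    · exact hF.bk _ h.2.2
  · intro q h
    simp only [Finset.mem_insert, Finset.mem_erase] at h
    rcases h with rfl | h
    · simp only; omega
    · exact hF.le _ h.2.2
  · intro i hi
    obtain ⟨q, hq0, h⟩ := hF.cov i hi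
    by_cases e1 : q = (a, c, k)
    · subst e1
      refine ⟨_, Finset.mem_insert_self _ _, ?_⟩
      simp only [InR] at h ⊢
      omega
    by_cases e2 : q = (a + k, c', l)
    · subst e2
      refine ⟨_, Finset.mem_insert_self _ _, ?_⟩
      simp only [InR] at h ⊢
      omega
    exact ⟨q, by simp [e1, e2, hq0], h⟩
  · intro q h q' h' i hi hi'
    simp only [Finset.mem_insert, Finset.mem_erase] at h h'
    rcases h with rfl | h <;> rcases h' with rfl | h'
    · rfl
    · exact (hother _ h'.2.2 h'.2.1 h'.1 i hi' hi).elim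
    · exact (hother _ h.2.2 h.2.1 h.1 i hi hi').elim
    · exact hF.uniq _ h.2.2 _ h'.2.2 i hi hi'
  · have h1 : (a + k, c', l) ∈ F.erase (a, c, k) := Finset.mem_erase.2 ⟨hne.symm, hq'⟩
    have h2 := Finset.card_erase_lt_of_mem h1
    have h3 := Finset.card_erase_lt_of_mem hq
    have h4 := Finset.card_insert_le (a, c0, k + l) ((F.erase (a, c, k)).erase (a + k, c', l))
    omega

theorem Fam.done {n : ℕ} (hn : 0 < n) {π : Equiv.Perm (Fin n)} (hπ : Full π) :
    ∀ (N : ℕ) (F : Finset (ℕ × ℕ × ℕ)), F.card ≤ N → Fam n (toF π) F → Bk (toF π) (0, 0, n) := by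
  have hinj : ∀ i j, i < n → j < n → toF π i = toF π j → i = j := by
    intro i j hi hj h
    unfold toF at h
    rw [dif_pos hi, dif_pos hj] at h
    simpa using π.injective (Fin.ext h)
  intro N
  induction N with
  | zero =>
    intro F hF h
    obtain ⟨q, hq, _⟩ := h.cov 0 hn
    have := Finset.card_pos.2 ⟨q, hq⟩
    omega
  | succ N ih =>
    intro F hc hF
    have huC : ∀ q ∈ F, ∀ q' ∈ F, ∀ j, InC q j → InC q' j → q = q' := by
      intro q hq q' hq' j hj hj'
      obtain ⟨i, h1, h2, h3⟩ := (hF.bk q hq).hits hj.1 hj.2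
      obtain ⟨i', h1', h2', h3'⟩ := (hF.bk q' hq').hits hj'.1 hj'.2
      have l1 := hF.le _ hq
      have l2 := hF.le _ hq'
      have : i = i' := hinj _ _ (by omega) (by omega) (by omega)
      subst this
      exact hF.uniq _ hq _ hq' i ⟨h1, h2⟩ ⟨h1', h2'⟩
    let T : Set (Fin n × Fin n) := {p | ∃ q ∈ F, InR q p.1 ∧ InC q p.2}
    have hg : graphOf π ⊆ T := by
      rintro ⟨x, y⟩ hxy
      simp only [graphOf, Set.mem_setOf_eq] at hxy
      obtain ⟨q, hq, h⟩ := hF.cov x x.2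
      refine ⟨q, hq, h, ?_⟩
      have := (hF.bk q hq).maps h.1 h.2
      rw [toF, dif_pos x.2] at this
      rw [hxy]
      exact this
    by_cases hT : PercClosed T
    · have hall : ∀ p, p ∈ T := by
        intro p
        have : p ∈ percClosure π := by rw [hπ]; trivial
        exact this T ⟨hg, hT⟩
      obtain ⟨q, hq, h1, h2⟩ := hall (⟨0, hn⟩, ⟨0, hn⟩)
      obtain ⟨q', hq', h1', h2'⟩ := hall (⟨0, hn⟩, ⟨n - 1, by omega⟩)
      obtain rfl := hF.uniq _ hq _ hq' _ h1 h1'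
      have hb := hF.bk _ hq
      have hl := hF.le _ hq
      obtain ⟨a, c, k⟩ := q
      simp only [InR, InC] at h1 h2 h1' h2' hl
      obtain rfl : a = 0 := by omega
      obtain rfl : c = 0 := by omega
      obtain rfl : k = n := by omega
      exact hb
    · suffices ∃ F', Fam n (toF π) F' ∧ F'.card < F.card by
        obtain ⟨F', h1, h2⟩ := this
        exact ih F' (by omega) h1
      unfold PercClosed at hT
      push Not at hT
      obtain ⟨⟨x, y⟩, ⟨⟨x1, y1⟩, ⟨q, hq, hr, hcq⟩, ⟨x2, y2⟩, ⟨q', hq', hr', hcq'⟩, hne, ad1, ad2⟩, hnot⟩ := hT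
      simp only [ne_eq, Prod.mk.injEq, Adj, Fin.ext_iff] at hne ad1 ad2 hr hr' hcq hcq'
      have hnq : ∀ q ∈ F, ¬ (InR q x ∧ InC q y) := fun q hq h => hnot ⟨q, hq, h⟩
      have e1 := hnq q hq
      by_cases hqq : q = q'
      · exfalso
        subst hqq
        simp only [InR, InC] at *
        omega
      · have R : ∀ i, ¬ (InR q i ∧ InR q' i) := fun i h => hqq (hF.uniq _ hq _ hq' i h.1 h.2)
        have C : ∀ i, ¬ (InC q i ∧ InC q' i) := fun i h => hqq (huC _ hq _ hq' i h.1 h.2)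
        have R1 := R q.1
        have R2 := R q'.1
        have R3 := R x
        have R4 := R x1
        have C1 := C q.2.1
        have C2 := C q'.2.1
        have C3 := C y
        have C4 := C y1
        simp only [InR, InC] at hr hr' hcq hcq' e1 R1 R2 R3 R4 C1 C2 C3 C4
        have hrows : q'.1 = q.1 + q.2.2 ∨ q.1 = q'.1 + q'.2.2 := by omega
        have hcols : q'.2.1 = q.2.1 + q.2.2 ∨ q.2.1 = q'.2.1 + q'.2.2 := by omega
        rcases hrows with h | h
        · exact hF.merge hq hq' h hcols
        · exact hF.merge hq' hq h hcols.symm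

theorem sep_of_full {n : ℕ} (hn : 0 < n) {π : Equiv.Perm (Fin n)} (hπ : Full π) :
    SepL (toL π) := by
  have hfam : Fam n (toF π) ((Finset.range n).image (fun i => (i, toF π i, 1))) := by
    refine ⟨?_, ?_, ?_, ?_⟩
    · intro q hq
      simp only [Finset.mem_image, Finset.mem_range] at hq
      obtain ⟨i, hi, rfl⟩ := hq
      exact ⟨[0], SepL.one, rfl, by simp [Pat]⟩
    · intro q hq
      simp only [Finset.mem_image, Finset.mem_range] at hq
      obtain ⟨i, hi, rfl⟩ := hq
      simp only; omega
    · intro i hi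
      exact ⟨_, Finset.mem_image_of_mem _ (Finset.mem_range.2 hi), by simp [InR]⟩
    · intro q hq q' hq' i hi hi'
      simp only [Finset.mem_image, Finset.mem_range] at hq hq'
      obtain ⟨x, hx, rfl⟩ := hq
      obtain ⟨y, hy, rfl⟩ := hq'
      simp only [InR] at hi hi'
      obtain rfl : x = y := by omega
      rfl
  obtain ⟨b, hb, hl, hp⟩ := Fam.done hn hπ _ _ le_rfl hfam
  have : toL π = b := by
    simp only at hl hp
    unfold Pat at hp
    rw [hl] at hp
    unfold toL
    rw [List.range_eq_range', hp]
    simp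
  rw [this]
  exact hb

theorem toL_get {n : ℕ} (π : Equiv.Perm (Fin n)) (i : Fin n) :
    (toL π)[(i : ℕ)]'(by rw [toL_length]; exact i.2) = (π i : ℕ) := by
  simp [toL, toF]

theorem toL_inj {n : ℕ} : Function.Injective (toL (n := n)) := by
  intro π σ h
  ext i
  rw [← toL_get, ← toL_get]
  simp only [h]

theorem toL_surj {n : ℕ} {l : List ℕ} (h : SepL l) (hl : l.length = n) :
    ∃ π : Equiv.Perm (Fin n), toL π = l := by
  subst hl
  let g : Fin l.length → Fin l.length := fun i => ⟨l[(i : ℕ)], h.lt (List.getElem_mem _)⟩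
  have hg : Function.Injective g := by
    intro i j hij
    simp only [g, Fin.mk.injEq] at hij
    exact Fin.ext ((h.nodup.getElem_inj_iff).1 hij)
  refine ⟨Equiv.ofBijective g (Finite.injective_iff_bijective.1 hg), ?_⟩
  apply List.ext_getElem
  · rw [toL_length]
  · intro i h1 h2
    have := toL_get (Equiv.ofBijective g (Finite.injective_iff_bijective.1 hg)) ⟨i, h2⟩
    simp only at this
    rw [this]
    simp [g]

theorem indec_iff {n : ℕ} (hn : 2 ≤ n) {π : Equiv.Perm (Fin n)} (h : SepL (toL π)) :
    Indecomposable π ↔ ¬ IncL (toL π) := by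
  unfold Indecomposable
  rw [not_iff_not]
  constructor
  · rintro ⟨k, h1, h2, h3⟩
    rcases h.cases' with h' | h' | h'
    · have := congrArg List.length h'
      rw [toL_length] at this
      simp at this
      omega
    · exact h'
    · exfalso
      refine h'.not_split k h1 (by rw [toL_length]; exact h2) ?_ ?_
      · have := toL_get π ⟨0, by omega⟩
        simp only at this
        rw [this]
        have : π ⟨0, by omega⟩ ∈ {i : Fin n | (i : ℕ) < k} := by
          rw [← h3]
          exact ⟨⟨0, by omega⟩, by simp; omega, rfl⟩
        exact this
      · have := toL_get π ⟨n - 1, by omega⟩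
        simp only [toL_length] at this ⊢
        rw [this]
        by_contra hlt
        push Not at hlt
        have : π ⟨n - 1, by omega⟩ ∈ {i : Fin n | (i : ℕ) < k} := hlt
        rw [← h3] at this
        obtain ⟨i, hi, he⟩ := this
        have := π.injective he
        subst this
        simp at hi
        omega
  · rintro ⟨a, b, ha, hb, he⟩
    have hlen := congrArg List.length he
    rw [toL_length] at hlen
    simp only [List.length_append, List.length_map] at hlen
    have pa := ha.pos
    have pb := hb.pos
    refine ⟨a.length, pa, by omega, ?_⟩
    have hget : ∀ i : Fin n, (π i : ℕ) < a.length ↔ (i : ℕ) < a.length := by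
      intro i
      rw [← toL_get]
      simp only [he]
      constructor
      · intro hi
        by_contra hge
        push Not at hge
        rw [List.getElem_append_right hge] at hi
        simp at hi
      · intro hi
        rw [List.getElem_append_left hi]
        exact ha.lt (List.getElem_mem _)
    ext j
    simp only [Set.mem_image, Set.mem_setOf_eq]
    constructor
    · rintro ⟨i, hi, rfl⟩
      exact (hget i).2 hi
    · intro hj
      refine ⟨π.symm j, ?_, by simp⟩
      rw [← hget]
      simpa using hj

theorem numFullIndec_eq {n : ℕ} (hn : 2 ≤ n) : numFullIndec n = (setI n).card := by
  unfold numFullIndec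
  rw [← Nat.subtype_card (p := fun l => l ∈ setI n) (setI n) (fun _ => Iff.rfl)]
  refine Nat.card_eq_of_bijective
    (fun x => ⟨toL x.1, ?_⟩) ⟨?_, ?_⟩
  · have h := sep_of_full (by omega) x.2.1
    exact mem_setI.2 ⟨⟨h, toL_length _⟩, (indec_iff hn h).1 x.2.2⟩
  · intro x y h
    simp only [Subtype.mk.injEq] at h
    exact Subtype.ext (toL_inj h)
  · rintro ⟨l, hl⟩
    have hl' := mem_setI.1 hl
    obtain ⟨π, rfl⟩ := toL_surj hl'.1.1 hl'.1.2
    exact ⟨⟨π, full_of_sep π hl'.1.1, (indec_iff hn hl'.1.1).2 hl'.2⟩, rfl⟩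

theorem stmt_15 (S : ℕ → ℕ) (hS0 : S 0 = 1)
    (hS : ∀ n, S (n + 1) = S n + ∑ j ∈ Finset.range (n + 1), S j * S (n - j)) :
    ∀ n : ℕ, 2 ≤ n → 2 * numFullIndec n = S (n - 1) := by
  intro n hn
  rw [numFullIndec_eq hn, two_I, if_neg (by omega), Nat.add_zero]
  obtain ⟨m, rfl⟩ : ∃ m, n = m + 1 := ⟨n - 1, by omega⟩
  exact card_A_S S hS0 hS m
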